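/- For every continuous function x : [0,1]² → ℝ and every δ with 0 < δ < 1, one has w(x, δ) ≤ 2 w'(x, δ). -/

import Mathlib

open Set

/-- A grid sequence determining a `δ`-partition of `[0,1]` in one coordinate:
`0 = a 0 < a 1 < ⋯ < a n = 1` with all gaps `a (i+1) - a i > δ`. -/
structure GridSeq (δ : ℝ) where
  n : ℕ
  a : ℕ → ℝ
  npos : 0 < n
  first : a 0 = 0
  last : a n = 1
  gap : ∀ i < n, δ < a (i + 1) - a i

/-- The `i`-th cell of the partition: `[a i, a (i+1))`, except the last cell which
also contains the point `1`, i.e. equals `[a (n-1), 1]`. -/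
def GridSeq.cell {δ : ℝ} (g : GridSeq δ) (i : ℕ) : Set ℝ :=
  if i + 1 = g.n then Set.Icc (g.a i) 1 else Set.Ico (g.a i) (g.a (i + 1))

/-- Oscillation of `x` over a set `A`. -/
noncomputable def osc (x : ℝ × ℝ → ℝ) (A : Set (ℝ × ℝ)) : ℝ :=
  sSup {d : ℝ | ∃ s ∈ A, ∃ t ∈ A, d = |x s - x t|}

/-- The modulus of continuity `w(x, δ)` of `x` on `[0,1]²` (with the sup-norm on `ℝ²`). -/
noncomputable def modulus (x : ℝ × ℝ → ℝ) (δ : ℝ) : ℝ :=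
  sSup {d : ℝ | ∃ s ∈ Set.Icc (0:ℝ) 1 ×ˢ Set.Icc (0:ℝ) 1,
    ∃ t ∈ Set.Icc (0:ℝ) 1 ×ˢ Set.Icc (0:ℝ) 1,
    max |s.1 - t.1| |s.2 - t.2| < δ ∧ d = |x s - x t|}

/-- The modulus `w'(x, δ)`: the infimum over `δ`-partitions of `[0,1]²` of the
maximum oscillation of `x` over the cells of the partition. -/
noncomputable def modulus' (x : ℝ × ℝ → ℝ) (δ : ℝ) : ℝ :=
  sInf {d : ℝ | ∃ g1 g2 : GridSeq δ,
    d = sSup {e : ℝ | ∃ i < g1.n, ∃ j < g2.n, e = osc x (g1.cell i ×ˢ g2.cell j)}}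


namespace GridSeq

variable {δ : ℝ} (g : GridSeq δ)

theorem nonneg (hδ : 0 < δ) {i : ℕ} (hi : i ≤ g.n) : 0 ≤ g.a i := by
  induction i with
  | zero => exact g.first.ge
  | succ k ih =>
    have h₁ := ih (by omega)
    have h₂ := g.gap k (by omega)
    linarith

theorem le_one (hδ : 0 < δ) {i : ℕ} (hi : i ≤ g.n) : g.a i ≤ 1 := by
  induction hi using Nat.decreasingInduction with
  | self => exact g.last.le
  | of_succ k hk ih =>
    have h₂ := g.gap k hk
    linarith

theorem mem_cell_iff {i : ℕ} {s : ℝ} (hs : s ≤ 1) :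
    s ∈ g.cell i ↔ g.a i ≤ s ∧ (i + 1 = g.n ∨ s < g.a (i + 1)) := by
  unfold cell
  split_ifs with h <;> simp [h, hs]

theorem cell_subset_Icc (hδ : 0 < δ) {i : ℕ} (hi : i < g.n) : g.cell i ⊆ Icc 0 1 := by
  have h₀ := g.nonneg hδ hi.le
  have h₁ := g.le_one hδ (Nat.succ_le_of_lt hi)
  unfold cell
  split_ifs
  · exact Icc_subset_Icc_left h₀
  · exact fun s hs => ⟨h₀.trans hs.1, hs.2.le.trans h₁⟩

theorem exists_mem_cell {s : ℝ} (hs : s ∈ Icc (0 : ℝ) 1) : ∃ i < g.n, s ∈ g.cell i := by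
  by_contra! hne
  have h : ∀ i < g.n, g.a i ≤ s := by
    intro i
    induction i with
    | zero => exact fun _ => g.first.trans_le hs.1
    | succ k ih =>
      intro hk
      have h₁ := ih (by omega)
      have h₂ := hne k (by omega)
      rw [g.mem_cell_iff hs.2] at h₂
      by_contra! h₃
      exact h₂ ⟨h₁, Or.inr h₃⟩
  have hn := g.npos
  refine hne (g.n - 1) (by omega) ?_
  rw [g.mem_cell_iff hs.2]
  exact ⟨h _ (by omega), Or.inl (by omega)⟩

/-- Two points at distance less than `δ` lie in cells whose closures meet. -/
theorem exists_mem_closure_cells (hδ : 0 < δ) {s t : ℝ} (hs : s ∈ Icc (0 : ℝ) 1)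
    (ht : t ∈ Icc (0 : ℝ) 1) (hst : |s - t| < δ) :
    ∃ i < g.n, ∃ k < g.n, ∃ p, s ∈ g.cell i ∧ t ∈ g.cell k ∧
      p ∈ closure (g.cell i) ∧ p ∈ closure (g.cell k) := by
  wlog hle : s ≤ t generalizing s t
  · obtain ⟨i, hi, k, hk, p, h₁, h₂, h₃, h₄⟩ :=
      this ht hs (by rwa [abs_sub_comm]) (le_of_not_ge hle)
    exact ⟨k, hk, i, hi, p, h₂, h₁, h₄, h₃⟩
  obtain ⟨i, hi, hsi⟩ := g.exists_mem_cell hs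
  by_cases hti : t ∈ g.cell i
  · exact ⟨i, hi, i, hi, s, hsi, hti, subset_closure hsi, subset_closure hsi⟩
  have hsi' := (g.mem_cell_iff hs.2).1 hsi
  rw [g.mem_cell_iff ht.2] at hti
  push Not at hti
  obtain ⟨hne, hge⟩ := hti (hsi'.1.trans hle)
  have hlt := hsi'.2.resolve_left hne
  have hi' : i + 1 < g.n := by omega
  have hgap := g.gap (i + 1) hi'
  have hdist := (abs_lt.1 hst).1
  refine ⟨i, hi, i + 1, hi', g.a (i + 1), hsi, ?_, ?_, subset_closure ?_⟩
  · rw [g.mem_cell_iff ht.2]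
    exact ⟨hge, Or.inr (by linarith)⟩
  · have hai : g.a i < g.a (i + 1) := hsi'.1.trans_lt hlt
    rw [cell, if_neg hne, closure_Ico hai.ne]
    exact right_mem_Icc.2 hai.le
  · rw [g.mem_cell_iff (g.le_one hδ hi'.le)]
    exact ⟨le_rfl, Or.inr (by linarith)⟩

/-- The partition of `[0,1]` into a single cell. -/
def trivial (hδ : δ < 1) : GridSeq δ where
  n := 1
  a i := i
  npos := one_pos
  first := Nat.cast_zero
  last := Nat.cast_one
  gap i _ := by simpa using hδ

end GridSeq

theorem abs_sub_le_osc {x : ℝ × ℝ → ℝ} {A : Set (ℝ × ℝ)} {C : ℝ}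
    (hC : ∀ s ∈ A, ∀ t ∈ A, |x s - x t| ≤ C) {s t : ℝ × ℝ} (hs : s ∈ A) (ht : t ∈ A) :
    |x s - x t| ≤ osc x A :=
  le_csSup ⟨C, by rintro _ ⟨s, hs, t, ht, rfl⟩; exact hC s hs t ht⟩ ⟨s, hs, t, ht, rfl⟩

theorem osc_nonneg (x : ℝ × ℝ → ℝ) (A : Set (ℝ × ℝ)) : 0 ≤ osc x A :=
  Real.sSup_nonneg (by rintro _ ⟨s, _, t, _, rfl⟩; exact abs_nonneg _)

theorem osc_le {x : ℝ × ℝ → ℝ} {A : Set (ℝ × ℝ)} {C : ℝ} (hC₀ : 0 ≤ C)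
    (hC : ∀ s ∈ A, ∀ t ∈ A, |x s - x t| ≤ C) : osc x A ≤ C :=
  Real.sSup_le (by rintro _ ⟨s, hs, t, ht, rfl⟩; exact hC s hs t ht) hC₀

/-- For every continuous `x : [0,1]² → ℝ` and `0 < δ < 1`, `w(x, δ) ≤ 2 w'(x, δ)`. -/
theorem w_le_two_wprime (x : ℝ × ℝ → ℝ)
    (hcont : ContinuousOn x (Set.Icc (0:ℝ) 1 ×ˢ Set.Icc (0:ℝ) 1))
    (δ : ℝ) (hδ0 : 0 < δ) (hδ1 : δ < 1) :
    modulus x δ ≤ 2 * modulus' x δ := by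
  obtain ⟨B, hB⟩ := (isCompact_Icc.prod isCompact_Icc).exists_bound_of_continuousOn hcont
  have hC : ∀ s ∈ Icc (0 : ℝ) 1 ×ˢ Icc (0 : ℝ) 1, ∀ t ∈ Icc (0 : ℝ) 1 ×ˢ Icc (0 : ℝ) 1,
      |x s - x t| ≤ B + B := fun s hs t ht =>
    (abs_sub _ _).trans (add_le_add (hB s hs) (hB t ht))
  have hC₀ : 0 ≤ B + B :=
    (abs_nonneg _).trans (hC (0, 0) (by simp) (0, 0) (by simp))
  suffices h : modulus x δ / 2 ≤ modulus' x δ by linarith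
  refine le_csInf ⟨_, GridSeq.trivial hδ1, GridSeq.trivial hδ1, rfl⟩ ?_
  rintro _ ⟨g, h, rfl⟩
  set M := sSup {e : ℝ | ∃ i < g.n, ∃ j < h.n, e = osc x (g.cell i ×ˢ h.cell j)}
  have hM₀ : 0 ≤ M :=
    Real.sSup_nonneg (by rintro _ ⟨i, _, j, _, rfl⟩; exact osc_nonneg _ _)
  have hsub : ∀ i < g.n, ∀ j < h.n,
      g.cell i ×ˢ h.cell j ⊆ Icc (0 : ℝ) 1 ×ˢ Icc (0 : ℝ) 1 := fun i hi j hj =>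
    prod_mono (g.cell_subset_Icc hδ0 hi) (h.cell_subset_Icc hδ0 hj)
  have hosc : ∀ i < g.n, ∀ j < h.n, osc x (g.cell i ×ˢ h.cell j) ≤ M := by
    intro i hi j hj
    refine le_csSup ⟨B + B, ?_⟩ ⟨i, hi, j, hj, rfl⟩
    rintro _ ⟨i, hi, j, hj, rfl⟩
    exact osc_le hC₀ fun s hs t ht => hC s (hsub i hi j hj hs) t (hsub i hi j hj ht)
  have hclosure : ∀ i < g.n, ∀ j < h.n, ∀ s ∈ g.cell i ×ˢ h.cell j,
      ∀ p ∈ closure (g.cell i ×ˢ h.cell j), |x s - x p| ≤ M := by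
    intro i hi j hj s hs p hp
    have hp' : p ∈ Icc (0 : ℝ) 1 ×ˢ Icc (0 : ℝ) 1 :=
      closure_minimal (hsub i hi j hj) (isClosed_Icc.prod isClosed_Icc) hp
    have hcp := (hcont p hp').mono (hsub i hi j hj)
    refine ContinuousWithinAt.closure_le hp (continuousWithinAt_const.sub hcp).abs
      continuousWithinAt_const fun q hq => ?_
    exact (abs_sub_le_osc (fun s hs t ht =>
      hC s (hsub i hi j hj hs) t (hsub i hi j hj ht)) hs hq).trans (hosc i hi j hj)
  suffices hw : modulus x δ ≤ 2 * M by linarith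
  refine Real.sSup_le ?_ (by linarith)
  rintro _ ⟨s, hs, t, ht, hst, rfl⟩
  obtain ⟨i, hi, k, hk, p, hsi, htk, hpi, hpk⟩ :=
    g.exists_mem_closure_cells hδ0 hs.1 ht.1 ((le_max_left _ _).trans_lt hst)
  obtain ⟨j, hj, l, hl, q, hsj, htl, hqj, hql⟩ :=
    h.exists_mem_closure_cells hδ0 hs.2 ht.2 ((le_max_right _ _).trans_lt hst)
  have h₁ := hclosure i hi j hj s ⟨hsi, hsj⟩ (p, q) (by rw [closure_prod_eq]; exact ⟨hpi, hqj⟩)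
  have h₂ := hclosure k hk l hl t ⟨htk, htl⟩ (p, q) (by rw [closure_prod_eq]; exact ⟨hpk, hql⟩)
  rw [abs_sub_comm] at h₂
  linarith [abs_sub_le (x s) (x (p, q)) (x t)]
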